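/- Let p be a prime number, G' a finite group, and G = G' × C_p the direct product of G' with a cyclic group C_p of order p. Let K be a field and assume: (i) char K = 0, or char K = l > 0 and G contains no non-trivial normal l-subgroup; (ii) K contains a primitive p-th root of unity; (iii) for every prime p' dividing the order of the center Z(G') with p' ≠ p, the field K does not contain a primitive p'-th root of unity. Then ed_K(G) = ed_K(G') + 1. -/

import Mathlib

noncomputable section

/-- The transcendence degree of `L` over `K`: the supremum of the cardinalities of
algebraically independent subsets of `L`. -/
noncomputable def trdeg (K L : Type*) [CommRing K] [CommRing L] [Algebra K L] : Cardinal :=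
  ⨆ s : {s : Set L // AlgebraicIndependent K ((↑) : s → L)}, Cardinal.mk s.1

/-- The rational function field over `K` on variables indexed by `σ` :
the fraction field of the polynomial ring `K[x_i : i ∈ σ]`. -/
abbrev FnField (K : Type*) [Field K] (σ : Type*) : Type _ :=
  FractionRing (MvPolynomial σ K)

/-- Permutations of the variables acting on the polynomial ring by `K`-algebra
automorphisms. -/
noncomputable def permHom (K : Type*) [Field K] (σ : Type*) :
    Equiv.Perm σ →* (MvPolynomial σ K ≃ₐ[K] MvPolynomial σ K) where
  toFun e := MvPolynomial.renameEquiv K e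
  map_one' := MvPolynomial.renameEquiv_refl K
  map_mul' e f := by
    ext x
    simp [MvPolynomial.renameEquiv, Equiv.Perm.mul_apply]

/-- Permutations of the variables acting on the rational function field by
`K`-algebra automorphisms. -/
noncomputable def permGalAction (K : Type*) [Field K] (σ : Type*) :
    Equiv.Perm σ →* (FnField K σ ≃ₐ[K] FnField K σ) :=
  (IsFractionRing.fieldEquivOfAlgEquivHom K (FnField K σ)).comp (permHom K σ)

/-- The action of a group `G` on its rational function field `K(x_g : g ∈ G)` by
`K`-algebra automorphisms, permuting the variables by left translation:
`σ • x_g = x_{σg}`. -/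
noncomputable def galAction (K : Type*) [Field K] (G : Type*) [Group G] :
    G →* (FnField K G ≃ₐ[K] FnField K G) :=
  (permGalAction K G).comp (MulAction.toPermHom G G)

/-- The essential dimension of a group `G` over the field `K`:
the minimum of the transcendence degrees over `K` of the `G`-stable intermediate
subfields of the rational function field `K(x_g : g ∈ G)` on which `G` acts
faithfully. -/
noncomputable def edK (K : Type*) [Field K] (G : Type*) [Group G] : ℕ :=
  sInf { d : ℕ | ∃ E : IntermediateField K (FnField K G),
    (∀ g : G, ∀ x ∈ E, galAction K G g x ∈ E) ∧
    (∀ g : G, g ≠ 1 → ∃ x ∈ E, galAction K G g x ≠ x) ∧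
    trdeg K E = d }

/-- If a domain `A` surjects onto `B` with non-trivial kernel, the transcendence degree drops. -/
theorem transcendental_adjoin_of_algebraicIndependent_comp {K A B ι : Type*} [Field K]
    [CommRing A] [IsDomain A] [CommRing B] [Algebra K A] [Algebra K B] (ψ : A →ₐ[K] B)
    {x : ι → A} (hx : AlgebraicIndependent K (ψ ∘ x)) {a : A} (ha : a ≠ 0) (h : ψ a = 0) :
    Transcendental (Algebra.adjoin K (Set.range x)) a := by
  have hinj : ∀ y : Algebra.adjoin K (Set.range x), ψ y = 0 → y = 0 := by
    rintro ⟨y, hy⟩ h0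
    rw [Algebra.adjoin_range_eq_range_aeval] at hy
    obtain ⟨P, rfl⟩ := hy
    have h1 : MvPolynomial.aeval (ψ ∘ x) P = 0 :=
      (MvPolynomial.comp_aeval_apply x ψ P).symm.trans h0
    have h2 : P = 0 := hx.eq_zero_of_aeval_eq_zero P h1
    ext
    simp [h2]
  have key : ∀ (n : ℕ) (p : Polynomial (Algebra.adjoin K (Set.range x))),
      Polynomial.aeval a p = 0 → p.coeff n = 0 := by
    intro n
    have step : ∀ p : Polynomial (Algebra.adjoin K (Set.range x)),
        Polynomial.aeval a p = 0 → p.coeff 0 = 0 ∧ Polynomial.aeval a p.divX = 0 := by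
      intro p hp
      rw [← Polynomial.divX_mul_X_add p] at hp
      simp only [map_add, map_mul, Polynomial.aeval_X, Polynomial.aeval_C] at hp
      have h0 : p.coeff 0 = 0 := by
        apply hinj
        have := congrArg ψ hp
        simpa [h, Algebra.algebraMap_eq_smul_one, Subalgebra.smul_def] using this
      refine ⟨h0, ?_⟩
      rw [h0] at hp
      simpa [ha] using hp
    induction n with
    | zero => exact fun p hp => (step p hp).1
    | succ n ih =>
      intro p hp
      rw [← Polynomial.coeff_divX]
      exact ih _ (step p hp).2
  rw [transcendental_iff]
  intro p hp
  ext n : 1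
  simpa using key n p hp

theorem trdeg_add_one_le_of_surjective_of_not_injective {K A B : Type*} [Field K]
    [CommRing A] [IsDomain A] [CommRing B] [IsDomain B] [Algebra K A] [Algebra K B]
    (ψ : A →ₐ[K] B) (hψ : Function.Surjective ψ) {a : A} (ha : a ≠ 0) (h : ψ a = 0) {d : ℕ}
    (hd : Algebra.trdeg K A ≤ d) : Algebra.trdeg K B + 1 ≤ d := by
  obtain ⟨s, hs⟩ := exists_isTranscendenceBasis K B
  let x : s → A := fun i => (hψ i).choose
  have hx : ψ ∘ x = fun i : s => (i : B) := by
    ext i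
    exact (hψ i).choose_spec
  have hind : AlgebraicIndependent K (ψ ∘ x) := by rw [hx]; exact hs.1
  have ho : AlgebraicIndependent K (fun o : Option s => o.elim a x) :=
    AlgebraicIndependent.option_iff.2 ⟨hind.of_comp ψ,
      transcendental_adjoin_of_algebraicIndependent_comp ψ hind ha h⟩
  have h1 := ho.lift_cardinalMk_le_trdeg.trans (Cardinal.lift_le.2 hd)
  rw [Cardinal.mk_option, hs.cardinalMk_eq_trdeg, Cardinal.lift_natCast] at h1
  exact Cardinal.lift_le_nat_iff.1 h1

/-- The residue field of a subfield `E` at a place `φ : O → F` of the field `L`. -/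
def residueField {K L F : Type*} [Field K] [Field L] [Field F] [Algebra K L] [Algebra K F]
    (O : Subalgebra K L) (φ : O →ₐ[K] F) (hO : ∀ x : O, φ x ≠ 0 → (x : L)⁻¹ ∈ O)
    (E : IntermediateField K L) : IntermediateField K F where
  toSubalgebra := (E.toSubalgebra.comap O.val).map φ
  inv_mem' := by
    rintro _ ⟨x, hx, rfl⟩
    by_cases h0 : φ x = 0
    · exact ⟨0, zero_mem _, by simp [h0]⟩
    · refine ⟨⟨_, hO x h0⟩, E.inv_mem hx, ?_⟩
      apply eq_inv_of_mul_eq_one_left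
      change φ ⟨_, hO x h0⟩ * φ x = 1
      rw [← map_mul, ← map_one φ]
      congr 1
      ext
      refine inv_mul_cancel₀ ?_
      rintro h
      apply h0
      rw [← map_zero φ]
      congr 1
      ext
      exact h

theorem mem_residueField {K L F : Type*} [Field K] [Field L] [Field F] [Algebra K L]
    [Algebra K F] {O : Subalgebra K L} {φ : O →ₐ[K] F} {hO : ∀ x : O, φ x ≠ 0 → (x : L)⁻¹ ∈ O}
    {E : IntermediateField K L} {y : F} :
    y ∈ residueField O φ hO E ↔ ∃ x : O, (x : L) ∈ E ∧ φ x = y := Iff.rfl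

/-- The ring of elements of `E` lying in the place ring, mapped onto the residue field. -/
def toResidueField {K L F : Type*} [Field K] [Field L] [Field F] [Algebra K L]
    [Algebra K F] (O : Subalgebra K L) (φ : O →ₐ[K] F)
    (hO : ∀ x : O, φ x ≠ 0 → (x : L)⁻¹ ∈ O) (E : IntermediateField K L) :
    E.toSubalgebra.comap O.val →ₐ[K] residueField O φ hO E :=
  (φ.comp (E.toSubalgebra.comap O.val).val).codRestrict (residueField O φ hO E).toSubalgebra
    fun x => mem_residueField.2 ⟨x.1, x.2, rfl⟩

theorem toResidueField_surjective {K L F : Type*} [Field K] [Field L] [Field F] [Algebra K L]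
    [Algebra K F] (O : Subalgebra K L) (φ : O →ₐ[K] F)
    (hO : ∀ x : O, φ x ≠ 0 → (x : L)⁻¹ ∈ O) (E : IntermediateField K L) :
    Function.Surjective (toResidueField O φ hO E) := by
  rintro ⟨y, hy⟩
  obtain ⟨x, hx, rfl⟩ := mem_residueField.1 hy
  exact ⟨⟨x, hx⟩, rfl⟩

theorem trdeg_comap_val_le {K L : Type*} [Field K] [Field L] [Algebra K L]
    (O : Subalgebra K L) (E : IntermediateField K L) :
    Algebra.trdeg K (E.toSubalgebra.comap O.val) ≤ Algebra.trdeg K E := by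
  refine trdeg_le_of_injective
    ((O.val.comp (E.toSubalgebra.comap O.val).val).codRestrict E.toSubalgebra fun x => x.2) ?_
  intro x y h
  ext
  exact congrArg (fun z : E.toSubalgebra => (z : L)) h

theorem trdeg_residueField_le {K L F : Type*} [Field K] [Field L]
    [Field F] [Algebra K L] [Algebra K F] (O : Subalgebra K L) (φ : O →ₐ[K] F)
    (hO : ∀ x : O, φ x ≠ 0 → (x : L)⁻¹ ∈ O) (E : IntermediateField K L) {d : ℕ}
    (hd : Algebra.trdeg K E ≤ d) : Algebra.trdeg K (residueField O φ hO E) ≤ d := by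
  have h1 := lift_trdeg_le_of_surjective _ (toResidueField_surjective O φ hO E)
  have h2 := h1.trans (Cardinal.lift_le.2 ((trdeg_comap_val_le O E).trans hd))
  simpa using h2

theorem trdeg_residueField_add_one_le {K L F : Type*} [Field K] [Field L]
    [Field F] [Algebra K L] [Algebra K F] (O : Subalgebra K L) (φ : O →ₐ[K] F)
    (hO : ∀ x : O, φ x ≠ 0 → (x : L)⁻¹ ∈ O) (E : IntermediateField K L) {d : ℕ}
    (hd : Algebra.trdeg K E ≤ d) {a : O} (haE : (a : L) ∈ E) (ha : a ≠ 0)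
    (h : φ a = 0) : Algebra.trdeg K (residueField O φ hO E) + 1 ≤ d := by
  refine trdeg_add_one_le_of_surjective_of_not_injective (toResidueField O φ hO E)
    (toResidueField_surjective O φ hO E) (a := ⟨a, haE⟩) ?_ ?_
    ((trdeg_comap_val_le O E).trans hd)
  · exact fun h0 => ha (congrArg Subtype.val h0)
  · exact Subtype.ext h


theorem exists_place_fractionRing {K P L F : Type*} [Field K] [CommRing P] [IsDomain P] [Field L]
    [Field F] [Algebra K P] [Algebra P L] [Algebra K L] [IsScalarTower K P L]
    [IsFractionRing P L] [Algebra K F] (φ₀ : P →ₐ[K] F) :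
    ∃ (O : Subalgebra K L) (φ : O →ₐ[K] F), (∀ x : O, φ x ≠ 0 → (x : L)⁻¹ ∈ O) ∧
      (∀ a : P, ∃ h : algebraMap P L a ∈ O, φ ⟨_, h⟩ = φ₀ a) ∧
      (∀ s : P, φ₀ s ≠ 0 → (algebraMap P L s)⁻¹ ∈ O) ∧
      (∀ x ∈ O, ∃ a s : P, φ₀ s ≠ 0 ∧ x = algebraMap P L a * (algebraMap P L s)⁻¹) := by
  let S : Submonoid P := (nonZeroDivisors F).comap φ₀
  have hS : S ≤ nonZeroDivisors P := by
    intro s hs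
    rw [mem_nonZeroDivisors_iff_ne_zero]
    rintro rfl
    simp [S] at hs
  let O' := Localization.subalgebra.ofField L S hS
  have hmem : ∀ x, x ∈ O' ↔ ∃ a s : P, ∃ _ : s ∈ S, x = algebraMap P L a * (algebraMap P L s)⁻¹ :=
    fun x => Iff.rfl
  let f : O' →+* F := IsLocalization.lift (M := S) (g := (φ₀ : P →+* F)) (fun s =>
    (mem_nonZeroDivisors_iff_ne_zero.1 (Submonoid.mem_comap.1 s.2)).isUnit)
  have hf : ∀ a : P, f (algebraMap P O' a) = φ₀ a := fun a =>
    IsLocalization.lift_eq _ a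
  let φ : O'.restrictScalars K →ₐ[K] F :=
    { f with
      commutes' := fun r => by
        rw [← φ₀.commutes, ← hf]
        change f _ = f _
        congr 1
        ext
        exact IsScalarTower.algebraMap_apply K P L r }
  have hinv : ∀ s : P, φ₀ s ≠ 0 → (algebraMap P L s)⁻¹ ∈ O' := fun s hs =>
    (hmem _).2 ⟨1, s, by simpa [S] using hs, by simp⟩
  refine ⟨O'.restrictScalars K, φ, ?_, ?_, hinv, ?_⟩
  · rintro ⟨x, hx⟩ h
    obtain ⟨a, s, hs, rfl⟩ := (hmem x).1 hx
    have h2 : f ⟨_, hx⟩ * φ₀ s = φ₀ a := by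
      rw [← hf, ← hf, ← map_mul]
      congr 1
      ext
      have : algebraMap P L s ≠ 0 := by
        simpa using nonZeroDivisors.ne_zero (hS hs)
      change algebraMap P L a * (algebraMap P L s)⁻¹ * algebraMap P L s = algebraMap P L a
      field_simp
    have h3 : φ₀ a ≠ 0 := by
      rw [← h2]
      exact mul_ne_zero h (by simpa [S] using hs)
    exact (hmem _).2 ⟨s, a, by simpa [S] using h3, by simp⟩
  · exact fun a => ⟨(algebraMap P O' a).2, hf a⟩
  · intro x hx
    obtain ⟨a, s, hs, rfl⟩ := (hmem x).1 hx
    exact ⟨a, s, by simpa [S] using hs, rfl⟩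

/-- Algebraic independence of the elements of a finite group of automorphisms of an
infinite field. -/
theorem exists_eval_smul_ne_zero {G F : Type*} [Group G] [Finite G] [Field F] [Infinite F]
    [MulSemiringAction G F] [FaithfulSMul G F] {s : MvPolynomial G F} (hs : s ≠ 0) :
    ∃ b : F, MvPolynomial.eval (fun g : G => g • b) s ≠ 0 := by
  classical
  have := Fintype.ofFinite G
  let F₀ := FixedPoints.subfield G F
  let e := Module.finBasisOfFinrankEq F₀ F (FixedPoints.finrank_eq_card G F)
  have hinf : Infinite F₀ := by
    by_contra h
    have : Finite F₀ := not_infinite_iff_finite.1 h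
    exact (Module.finite_of_finite F₀ (M := F)).not_infinite ‹_›
  let eG := Fintype.equivFin G
  let M : Matrix G G F := Matrix.of fun g h => g • e (eG h)
  have hM : IsUnit M := by
    rw [← Matrix.linearIndependent_rows_iff_isUnit]
    rw [Fintype.linearIndependent_iff]
    intro c hc
    have hlin : ∀ x : F, ∑ g, c g * g • x = 0 := by
      intro x
      rw [← e.sum_repr x]
      simp_rw [Finset.smul_sum, Finset.mul_sum]
      rw [Finset.sum_comm]
      refine Finset.sum_eq_zero fun i _ => ?_
      have h1 := congrFun hc (eG.symm i)
      simp only [Finset.sum_apply, Pi.smul_apply, Matrix.row, M, Matrix.of_apply,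
        Equiv.apply_symm_apply, smul_eq_mul, Pi.zero_apply] at h1
      calc _ = ((e.repr x i : F₀) : F) * ∑ g, c g * g • e i := by
            rw [Finset.mul_sum]
            refine Finset.sum_congr rfl fun g _ => ?_
            rw [Subfield.smul_def, smul_eq_mul, smul_mul', (e.repr x i).2 g]
            ring
        _ = 0 := by rw [h1, mul_zero]
    have hind := linearIndependent_monoidHom F F
    have hinj : Function.Injective
        (fun g : G => ((MulSemiringAction.toRingHom G F g : F →+* F) : F →* F)) := by
      intro g h hgh
      exact FaithfulSMul.eq_of_smul_eq_smul (α := F) fun x => DFunLike.congr_fun hgh x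
    have := hind.comp _ hinj
    rw [Fintype.linearIndependent_iff] at this
    refine this c ?_
    ext x
    simpa using hlin x
  obtain ⟨N, hMN, hNM⟩ : ∃ N, M * N = 1 ∧ N * M = 1 := by
    obtain ⟨u, hu⟩ := hM
    exact ⟨↑u⁻¹, by rw [← hu]; simp, by rw [← hu]; simp⟩
  let T : Matrix G G F → MvPolynomial G F →ₐ[F] MvPolynomial G F := fun A =>
    MvPolynomial.aeval fun g => ∑ h, MvPolynomial.C (A g h) * MvPolynomial.X h
  have hT : T N (T M s) = s := by
    have : (T N).comp (T M) = AlgHom.id F _ := by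
      ext g : 1
      simp only [T, AlgHom.comp_apply, MvPolynomial.aeval_X, map_sum, map_mul,
        AlgHom.id_apply, ← MvPolynomial.algebraMap_eq, AlgHom.commutes]
      simp_rw [Finset.mul_sum, ← mul_assoc, ← map_mul]
      rw [Finset.sum_comm]
      simp_rw [← Finset.sum_mul, ← map_sum, ← Matrix.mul_apply, hMN, Matrix.one_apply]
      simp
    exact DFunLike.congr_fun this s
  have hq : T M s ≠ 0 := by
    intro h
    rw [h, map_zero] at hT
    exact hs hT.symm
  obtain ⟨a, ha, hne⟩ : ∃ a ∈ Set.pi Set.univ (fun _ : G => (F₀ : Set F)),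
      MvPolynomial.eval a (T M s) ≠ 0 := by
    by_contra! hcon
    refine hq (MvPolynomial.funext_set (fun _ : G => (F₀ : Set F))
      (fun _ => Set.infinite_coe_iff.1 hinf) fun x hx => ?_)
    rw [hcon x hx, map_zero]
  refine ⟨∑ h, a h * e (eG h), ?_⟩
  convert hne using 1
  simp only [T]
  rw [MvPolynomial.aeval_def, MvPolynomial.algebraMap_eq, MvPolynomial.eval₂_eq', map_sum,
    MvPolynomial.eval_eq']
  refine Finset.sum_congr rfl fun d _ => ?_
  simp only [map_mul, map_prod, map_pow, map_sum, MvPolynomial.eval_C, MvPolynomial.eval_X]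
  congr 1
  refine Finset.prod_congr rfl fun g _ => ?_
  congr 1
  rw [Finset.smul_sum]
  refine Finset.sum_congr rfl fun h _ => ?_
  rw [smul_mul', ha h trivial g, mul_comm]
  rfl

/-- An intermediate field is a faithful stable subfield for an action if it is stable under the
action and the restricted action is faithful. -/
def IsFaithfulStable {K L G : Type*} [Field K] [Field L] [Algebra K L] [Group G]
    (ρ : G →* (L ≃ₐ[K] L)) (E : IntermediateField K L) : Prop :=
  (∀ g : G, ∀ x ∈ E, ρ g x ∈ E) ∧ ∀ g : G, g ≠ 1 → ∃ x ∈ E, ρ g x ≠ x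

theorem galAction_algebraMap {K G : Type*} [Field K] [Group G] (g : G) (P : MvPolynomial G K) :
    galAction K G g (algebraMap _ (FnField K G) P) =
      algebraMap _ (FnField K G) (MvPolynomial.rename (g * ·) P) := by
  simp only [galAction, permGalAction, MonoidHom.comp_apply,
    IsFractionRing.fieldEquivOfAlgEquivHom_apply, IsFractionRing.fieldEquivOfAlgEquiv_algebraMap]
  rfl

theorem edK_le {K G : Type*} [Field K] [Group G] {E : IntermediateField K (FnField K G)}
    (hE : IsFaithfulStable (galAction K G) E) {d : ℕ} (hd : Algebra.trdeg K E ≤ d) :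
    edK K G ≤ d := by
  obtain ⟨n, hn⟩ := Cardinal.lt_aleph0.1 (hd.trans_lt (Cardinal.natCast_lt_aleph0))
  have h : edK K G ≤ n := Nat.sInf_le ⟨E, hE.1, hE.2, hn⟩
  rw [hn] at hd
  exact h.trans (by exact_mod_cast hd)

theorem isFaithfulStable_galAction_top (K G : Type*) [Field K] [Group G] :
    IsFaithfulStable (galAction K G) ⊤ := by
  refine ⟨fun _ _ _ => trivial, fun g hg => ?_⟩
  refine ⟨algebraMap (MvPolynomial G K) _ (MvPolynomial.X 1), trivial, fun h => hg ?_⟩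
  rw [galAction_algebraMap, MvPolynomial.rename_X] at h
  have h1 := MvPolynomial.X_injective (IsFractionRing.injective (MvPolynomial G K) (FnField K G) h)
  simpa using h1

theorem trdeg_top_fnField (K G : Type*) [Field K] [Finite G] :
    Algebra.trdeg K (⊤ : IntermediateField K (FnField K G)) ≤ (Nat.card G : ℕ) := by
  refine (trdeg_le_of_injective (IntermediateField.topEquiv (F := K) (E := FnField K G)).toAlgHom
    (AlgEquiv.injective _)).trans ?_
  have := IsLocalization.isAlgebraic (R := MvPolynomial G K) (S := FnField K G)
    (nonZeroDivisors (MvPolynomial G K))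
  have h := trdeg_add_eq K (MvPolynomial G K) (A := FnField K G)
  rw [← h, trdeg_eq_zero (R := MvPolynomial G K), add_zero,
    MvPolynomial.trdeg_of_isDomain, ← Nat.cast_card,
    Cardinal.lift_natCast]

theorem exists_isFaithfulStable_edK (K G : Type*) [Field K] [Group G] [Finite G] :
    ∃ E : IntermediateField K (FnField K G), IsFaithfulStable (galAction K G) E ∧
      Algebra.trdeg K E ≤ edK K G := by
  have hne : { d : ℕ | ∃ E : IntermediateField K (FnField K G),
      (∀ g : G, ∀ x ∈ E, galAction K G g x ∈ E) ∧
      (∀ g : G, g ≠ 1 → ∃ x ∈ E, galAction K G g x ≠ x) ∧ trdeg K E = d }.Nonempty := by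
    obtain ⟨n, hn⟩ := Cardinal.lt_aleph0.1
      ((trdeg_top_fnField K G).trans_lt (Cardinal.natCast_lt_aleph0))
    have h := isFaithfulStable_galAction_top K G
    exact ⟨n, ⊤, h.1, h.2, hn⟩
  obtain ⟨E, h1, h2, h3⟩ := Nat.sInf_mem hne
  exact ⟨E, ⟨h1, h2⟩, h3.le⟩

theorem isFaithfulStable_residueField {K L F G : Type*} [Field K] [Field L] [Field F]
    [Algebra K L] [Algebra K F] [Group G] (ρ : G →* (L ≃ₐ[K] L)) (ρ' : G →* (F ≃ₐ[K] F))
    {O : Subalgebra K L} {φ : O →ₐ[K] F} (hO : ∀ x : O, φ x ≠ 0 → (x : L)⁻¹ ∈ O)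
    (hρ : ∀ (g : G) (x : O), ∃ h : ρ g x ∈ O, φ ⟨_, h⟩ = ρ' g (φ x))
    {E : IntermediateField K L} (hE : ∀ g : G, ∀ x ∈ E, ρ g x ∈ E)
    (hf : ∀ g : G, g ≠ 1 → ∃ x : O, (x : L) ∈ E ∧ ρ' g (φ x) ≠ φ x) :
    IsFaithfulStable ρ' (residueField O φ hO E) := by
  constructor
  · intro g y hy
    obtain ⟨x, hx, rfl⟩ := mem_residueField.1 hy
    obtain ⟨h, h'⟩ := hρ g x
    exact mem_residueField.2 ⟨⟨_, h⟩, hE g x hx, h'⟩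
  · intro g hg
    obtain ⟨x, hx, hne⟩ := hf g hg
    exact ⟨φ x, mem_residueField.2 ⟨x, hx, rfl⟩, hne⟩

theorem exists_aeval_ne_zero {K G F : Type*} [Field K] [Group G] [Finite G] [Field F]
    [Infinite F] [Algebra K F] {ρ : G →* (F ≃ₐ[K] F)} (hρ : Function.Injective ρ)
    {s : MvPolynomial G K} (hs : s ≠ 0) :
    ∃ b : F, MvPolynomial.aeval (fun g : G => ρ g b) s ≠ 0 := by
  let : MulSemiringAction G F := MulSemiringAction.compHom F ρ
  have : FaithfulSMul G F := ⟨fun {g h} hgh => hρ (AlgEquiv.ext hgh)⟩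
  have hs' : MvPolynomial.map (algebraMap K F) s ≠ 0 := by
    rwa [Ne, map_eq_zero_iff _ (MvPolynomial.map_injective _ (algebraMap K F).injective)]
  obtain ⟨b, hb⟩ := exists_eval_smul_ne_zero hs'
  refine ⟨b, ?_⟩
  rw [MvPolynomial.eval_map] at hb
  exact hb

/-- A faithful stable subfield of the rational function field of the regular representation
specializes to one of any infinite field with a faithful action, without increasing the
transcendence degree. -/
theorem IsFaithfulStable.exists_of_infinite {K G F : Type*} [Field K] [Group G] [Finite G]
    [Field F] [Infinite F] [Algebra K F] {ρ : G →* (F ≃ₐ[K] F)} (hρ : Function.Injective ρ)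
    {E : IntermediateField K (FnField K G)} (hE : IsFaithfulStable (galAction K G) E) {d : ℕ}
    (hd : Algebra.trdeg K E ≤ d) :
    ∃ E' : IntermediateField K F, IsFaithfulStable ρ E' ∧ Algebra.trdeg K E' ≤ d := by
  classical
  have := Fintype.ofFinite G
  have hfrac : ∀ x : FnField K G, ∃ a s : MvPolynomial G K, s ≠ 0 ∧
      algebraMap _ (FnField K G) s * x = algebraMap _ _ a := by
    intro x
    obtain ⟨a, s, hs, rfl⟩ := IsFractionRing.div_surjective (A := MvPolynomial G K) x
    have hs0 : s ≠ 0 := nonZeroDivisors.ne_zero hs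
    refine ⟨a, s, hs0, mul_div_cancel₀ _ ?_⟩
    simpa using hs0
  have hx : ∀ g : G, ∃ x ∈ E, g ≠ 1 → galAction K G g x ≠ x := by
    intro g
    by_cases hg : g = 1
    · exact ⟨0, zero_mem _, fun h => absurd hg h⟩
    · obtain ⟨x, hx, hne⟩ := hE.2 g hg
      exact ⟨x, hx, fun _ => hne⟩
  choose x hxE hxne using hx
  choose a s hs hsa using hfrac
  let r : G → MvPolynomial G K := fun g =>
    if g = 1 then 1 else a (galAction K G g (x g) - x g)
  have hr : ∀ g, r g ≠ 0 := by
    intro g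
    by_cases hg : g = 1
    · simp [r, hg]
    · simp only [r, if_neg hg]
      intro h0
      have h1 := hsa (galAction K G g (x g) - x g)
      rw [h0, map_zero, mul_eq_zero, sub_eq_zero] at h1
      rcases h1 with h1 | h1
      · exact hs _ (by simpa using h1)
      · exact hxne g hg h1
  obtain ⟨b, hb⟩ := exists_aeval_ne_zero hρ
    (Finset.prod_ne_zero_iff.2 fun g (_ : g ∈ Finset.univ) => mul_ne_zero (hs (x g)) (hr g))
  rw [map_prod, Finset.prod_ne_zero_iff] at hb
  let φ₀ : MvPolynomial G K →ₐ[K] F := MvPolynomial.aeval (fun g : G => ρ g b)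
  have hφ₀ : ∀ g P, φ₀ (MvPolynomial.rename (g * ·) P) = ρ g (φ₀ P) := by
    intro g P
    have : φ₀.comp (MvPolynomial.rename (g * ·)) = ((ρ g : F ≃ₐ[K] F) : F →ₐ[K] F).comp φ₀ := by
      ext h
      simp [φ₀]
    exact DFunLike.congr_fun this P
  obtain ⟨O, φ, hO, hmem, hinv, hrep⟩ := exists_place_fractionRing (L := FnField K G) φ₀
  have hmul : ∀ (y : O) (c t : MvPolynomial G K),
      algebraMap _ (FnField K G) t * y = algebraMap _ _ c → φ₀ t * φ y = φ₀ c := by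
    intro y c t h
    obtain ⟨hc, hc'⟩ := hmem c
    obtain ⟨ht, ht'⟩ := hmem t
    rw [← hc', ← ht', ← map_mul]
    congr 1
    exact Subtype.ext h
  have hequiv : ∀ (g : G) (y : O), ∃ h : galAction K G g y ∈ O, φ ⟨_, h⟩ = ρ g (φ y) := by
    rintro g ⟨y, hy⟩
    obtain ⟨c, t, ht, hyct⟩ := hrep y hy
    have ht0 : algebraMap _ (FnField K G) t ≠ 0 := by
      intro h
      apply ht
      rw [(map_eq_zero_iff _ (IsFractionRing.injective _ _)).1 h, map_zero]
    have hty : algebraMap _ (FnField K G) t * y = algebraMap _ _ c := by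
      rw [hyct]; field_simp
    have htg : φ₀ (MvPolynomial.rename (g * ·) t) ≠ 0 := by
      rw [hφ₀]; simpa using ht
    have hgy : galAction K G g y ∈ O := by
      rw [hyct, map_mul, map_inv₀, galAction_algebraMap, galAction_algebraMap]
      exact mul_mem (hmem _).1 (hinv _ htg)
    refine ⟨hgy, ?_⟩
    have h1 := hmul ⟨_, hgy⟩ (MvPolynomial.rename (g * ·) c) (MvPolynomial.rename (g * ·) t) (by
      rw [← galAction_algebraMap, ← galAction_algebraMap, ← map_mul, hty])
    have h2 := hmul ⟨y, hy⟩ c t hty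
    rw [hφ₀, hφ₀, ← h2, map_mul] at h1
    exact mul_left_cancel₀ (by simpa using ht) h1
  refine ⟨residueField O φ hO E, isFaithfulStable_residueField _ _ hO hequiv hE.1 ?_,
    trdeg_residueField_le O φ hO E hd⟩
  intro g hg
  have hbg := hb g (Finset.mem_univ g)
  rw [map_mul, mul_ne_zero_iff] at hbg
  have hxO : x g ∈ O := by
    have h1 : x g = algebraMap _ _ (a (x g)) * (algebraMap _ (FnField K G) (s (x g)))⁻¹ := by
      rw [← hsa]
      have : algebraMap _ (FnField K G) (s (x g)) ≠ 0 := by simpa using hs (x g)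
      field_simp
    rw [h1]
    exact mul_mem (hmem _).1 (hinv _ hbg.1)
  refine ⟨⟨x g, hxO⟩, hxE g, fun h => ?_⟩
  obtain ⟨h1, h2⟩ := hequiv g ⟨x g, hxO⟩
  have h3 := hmul (⟨_, h1⟩ - ⟨x g, hxO⟩) _ _ (hsa (galAction K G g (x g) - x g))
  rw [map_sub, h2, h, sub_self, mul_zero] at h3
  apply hbg.2
  simp only [r, if_neg hg]
  exact h3.symm

/-- The rational function field of `H` embeds equivariantly into the one of `H × C`. -/
theorem exists_algHom_fnField_prod (K H C : Type*) [Field K] [Group H] [Group C] [Finite C] :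
    ∃ j : FnField K H →ₐ[K] FnField K (H × C), ∀ (g : H × C) (x : FnField K H),
      galAction K (H × C) g (j x) = j (galAction K H g.1 x) := by
  classical
  have := Fintype.ofFinite C
  let i₀ : MvPolynomial H K →ₐ[K] MvPolynomial (H × C) K :=
    MvPolynomial.aeval fun h => ∑ c : C, MvPolynomial.X (h, c)
  let r₀ : MvPolynomial (H × C) K →ₐ[K] MvPolynomial H K :=
    MvPolynomial.aeval fun g => if g.2 = 1 then MvPolynomial.X g.1 else 0
  have hri : r₀.comp i₀ = AlgHom.id K (MvPolynomial H K) := by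
    ext h : 1
    simp [i₀, r₀]
  have hi₀ : Function.Injective i₀ :=
    Function.LeftInverse.injective (g := r₀) fun x => DFunLike.congr_fun hri x
  have hact : ∀ (g : H × C) (P : MvPolynomial H K),
      MvPolynomial.rename (g * ·) (i₀ P) = i₀ (MvPolynomial.rename (g.1 * ·) P) := by
    intro g P
    have : (MvPolynomial.rename (g * ·)).comp i₀ = i₀.comp (MvPolynomial.rename (g.1 * ·)) := by
      ext h : 1
      simp only [i₀, AlgHom.comp_apply, MvPolynomial.aeval_X, map_sum, MvPolynomial.rename_X]
      exact Fintype.sum_equiv (Equiv.mulLeft g.2) _ _ fun c => rfl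
    exact DFunLike.congr_fun this P
  have hg : Function.Injective
      ((IsScalarTower.toAlgHom K (MvPolynomial (H × C) K) (FnField K (H × C))).comp i₀) :=
    (IsFractionRing.injective (MvPolynomial (H × C) K) (FnField K (H × C))).comp hi₀
  have hj : ∀ P : MvPolynomial H K,
      IsFractionRing.liftAlgHom (g := (IsScalarTower.toAlgHom K (MvPolynomial (H × C) K)
        (FnField K (H × C))).comp i₀) hg (algebraMap _ (FnField K H) P) = algebraMap _ _ (i₀ P) :=
    fun P => IsFractionRing.lift_algebraMap hg P
  refine ⟨IsFractionRing.liftAlgHom (g := (IsScalarTower.toAlgHom K (MvPolynomial (H × C) K)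
        (FnField K (H × C))).comp i₀) hg, fun g x => ?_⟩
  obtain ⟨a, s, -, rfl⟩ := IsFractionRing.div_surjective (A := MvPolynomial H K) x
  simp only [map_div₀, hj, galAction_algebraMap, hact]

/-- The rational function field of a finite group contains an eigenvector for every character. -/
theorem exists_galAction_eq_smul {K G : Type*} [Field K] [Group G] [Finite G] (ψ : G →* Kˣ) :
    ∃ z : FnField K G, z ≠ 0 ∧ ∀ g : G, galAction K G g z = (ψ g : K) • z := by
  classical
  have := Fintype.ofFinite G
  let z₀ : MvPolynomial G K := ∑ g : G, MvPolynomial.C ((ψ g)⁻¹ : Kˣ).1 * MvPolynomial.X g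
  have hz₀ : z₀ ≠ 0 := by
    intro h
    have := congrArg (MvPolynomial.coeff (Finsupp.single (1 : G) 1)) h
    simp [z₀, MvPolynomial.coeff_sum, MvPolynomial.coeff_C_mul, MvPolynomial.coeff_X,
      Finsupp.single_left_inj] at this
  refine ⟨algebraMap _ (FnField K G) z₀, by simpa using hz₀, fun g => ?_⟩
  have h : MvPolynomial.rename (g * ·) z₀ = (ψ g : K) • z₀ := by
    simp only [z₀, map_sum, map_mul, MvPolynomial.rename_C, MvPolynomial.rename_X,
      Finset.smul_sum, MvPolynomial.smul_eq_C_mul]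
    refine Fintype.sum_equiv (Equiv.mulLeft g) _ _ fun x => ?_
    rw [← mul_assoc, ← map_mul]
    congr 2
    rw [Equiv.coe_mulLeft, map_mul, mul_inv_rev, Units.val_mul, mul_left_comm, Units.mul_inv,
      mul_one]
  rw [galAction_algebraMap, h, Algebra.algebraMap_eq_smul_one, smul_assoc,
    ← Algebra.algebraMap_eq_smul_one]

theorem trdeg_adjoin_simple_le {k F : Type*} [Field k] [Field F] [Algebra k F] (z : F) :
    Algebra.trdeg k (IntermediateField.adjoin k {z}) ≤ 1 := by
  have hg : IntermediateField.adjoin k {IntermediateField.AdjoinSimple.gen k z} = ⊤ := by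
    apply IntermediateField.lift_injective (IntermediateField.adjoin k {z})
    rw [IntermediateField.lift_adjoin_simple, IntermediateField.lift_top,
      IntermediateField.AdjoinSimple.coe_gen]
  have : Algebra.IsAlgebraic (Algebra.adjoin k {IntermediateField.AdjoinSimple.gen k z})
      (IntermediateField.adjoin k {z}) := by
    rw [← IntermediateField.isAlgebraic_adjoin_iff_top, hg]
    infer_instance
  simpa using Algebra.IsAlgebraic.trdeg_le_cardinalMk k {IntermediateField.AdjoinSimple.gen k z}

theorem trdeg_map_sup_adjoin_simple_le {K L F : Type*} [Field K] [Field L] [Field F] [Algebra K L]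
    [Algebra K F] (E : IntermediateField K L) (j : L →ₐ[K] F) (z : F) {d : ℕ}
    (hd : Algebra.trdeg K E ≤ d) :
    Algebra.trdeg K ↥(E.map j ⊔ IntermediateField.adjoin K {z}) ≤ (d + 1 : ℕ) := by
  let E₁ := E.map j
  let M := IntermediateField.adjoin E₁ {z}
  have hle : E₁ ⊔ IntermediateField.adjoin K {z} ≤ M.restrictScalars K := by
    refine sup_le (fun x hx => ?_) (IntermediateField.adjoin_simple_le_iff.2 ?_)
    · exact M.algebraMap_mem ⟨x, hx⟩
    · exact IntermediateField.mem_adjoin_simple_self E₁ z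
  have hE₁ : Algebra.trdeg K E₁ ≤ d := by
    have h1 := lift_trdeg_le_of_surjective (E.equivMap j).toAlgHom (E.equivMap j).surjective
    have h2 := h1.trans (Cardinal.lift_le.2 hd)
    simpa using h2
  have hM : Algebra.trdeg E₁ M ≤ 1 := trdeg_adjoin_simple_le z
  have hKM : Algebra.trdeg K M ≤ (d + 1 : ℕ) := by
    have : FaithfulSMul E₁ M :=
      (faithfulSMul_iff_algebraMap_injective _ _).2 (algebraMap E₁ M).injective
    rw [← trdeg_add_eq K E₁ (A := M), Nat.cast_add, Nat.cast_one]
    exact add_le_add hE₁ hM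
  exact (trdeg_le_of_injective (IntermediateField.inclusion hle)
    (IntermediateField.inclusion_injective hle)).trans hKM

/-- The upper bound, from the sum of the regular representation of `H` and a faithful
character of `C`. -/
theorem edK_prod_le {K H C : Type*} [Field K] [Group H] [Finite H] [Group C] [Finite C]
    (ψ : C →* Kˣ) (hψ : Function.Injective ψ) : edK K (H × C) ≤ edK K H + 1 := by
  obtain ⟨E, hE, hd⟩ := exists_isFaithfulStable_edK K H
  obtain ⟨j, hjact⟩ := exists_algHom_fnField_prod K H C
  obtain ⟨z, hz, hzact⟩ := exists_galAction_eq_smul (ψ.comp (MonoidHom.snd H C))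
  let E₂ : IntermediateField K (FnField K (H × C)) :=
    E.map j ⊔ IntermediateField.adjoin K {z}
  have hzE : z ∈ E₂ := (le_sup_right : _ ≤ E₂) (IntermediateField.mem_adjoin_simple_self K z)
  have hjE : ∀ x ∈ E, j x ∈ E₂ := fun x hx => (le_sup_left : _ ≤ E₂) ⟨x, hx, rfl⟩
  have hstab : ∀ g, E₂ ≤ E₂.comap (galAction K (H × C) g : _ →ₐ[K] _) := by
    intro g
    refine sup_le ?_ ?_
    · rintro _ ⟨x, hx, rfl⟩
      change galAction K (H × C) g (j x) ∈ E₂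
      rw [hjact]
      exact hjE _ (hE.1 _ x hx)
    · rw [IntermediateField.adjoin_simple_le_iff]
      change galAction K (H × C) g z ∈ E₂
      rw [hzact]
      exact E₂.smul_mem hzE
  refine edK_le (E := E₂) ⟨fun g x hx => hstab g hx, ?_⟩ ?_
  · intro g hg
    by_cases hg1 : g.1 = 1
    · refine ⟨z, hzE, fun h => ?_⟩
      rw [hzact] at h
      change (ψ g.2 : K) • z = z at h
      have h1 : (ψ g.2 : K) = 1 := by
        have h2 : ((ψ g.2 : K) - 1) • z = 0 := by rw [sub_smul, h, one_smul, sub_self]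
        rcases smul_eq_zero.1 h2 with h2 | h2
        · exact sub_eq_zero.1 h2
        · exact absurd h2 hz
      refine hg (Prod.ext hg1 (hψ ?_))
      simpa using h1
    · obtain ⟨x, hx, hne⟩ := hE.2 g.1 hg1
      refine ⟨j x, hjE x hx, fun h => hne ?_⟩
      rw [hjact] at h
      exact j.injective h
  · exact trdeg_map_sup_adjoin_simple_le E j z hd

theorem algebraMap_hahnSeries_int {K k : Type*} [Field K] [Field k] [Algebra K k] (r : K) :
    algebraMap K (HahnSeries ℤ k) r = HahnSeries.single 0 (algebraMap K k r) := by
  rw [HahnSeries.algebraMap_apply', PowerSeries.algebraMap_apply, HahnSeries.ofPowerSeries_C,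
    HahnSeries.C_apply]

/-- The endomorphism of the field of Laurent series `k((t))` given by an endomorphism of `k` and
`t ↦ u t`. -/
def laurentHom {K k : Type*} [Field K] [Field k] [Algebra K k] (σ : k →ₐ[K] k) (u : Kˣ) :
    HahnSeries ℤ k →ₐ[K] HahnSeries ℤ k where
  toFun f :=
    { coeff := fun n => ((u ^ n : Kˣ) : K) • σ (f.coeff n)
      isPWO_support' := f.isPWO_support.mono fun n hn h => hn (by simp [h]) }
  map_one' := by
    ext n
    by_cases hn : n = 0 <;> simp [HahnSeries.coeff_one, hn]
  map_zero' := by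
    ext n
    simp
  map_add' f g := by
    ext n
    simp
  map_mul' f g := by
    ext n
    simp only [HahnSeries.coeff_mul, map_sum, map_mul, Finset.smul_sum]
    refine Finset.sum_congr ?_ fun ij hij => ?_
    · ext ij
      simp only [Finset.mem_antidiagonal, HahnSeries.mem_support, smul_ne_zero_iff, Units.ne_zero,
        ne_eq, not_false_eq_true, true_and, map_eq_zero]
    · rw [Finset.mem_antidiagonal] at hij
      rw [smul_mul_smul_comm, ← Units.val_mul, ← zpow_add, hij.2.2]
  commutes' r := by
    ext n
    by_cases hn : n = 0 <;> simp [algebraMap_hahnSeries_int, hn]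

@[simp]
theorem coeff_laurentHom {K k : Type*} [Field K] [Field k] [Algebra K k] (σ : k →ₐ[K] k) (u : Kˣ)
    (f : HahnSeries ℤ k) (n : ℤ) :
    (laurentHom σ u f).coeff n = ((u ^ n : Kˣ) : K) • σ (f.coeff n) := rfl

/-- The action on the field of Laurent series `k((t))` combining an action on `k` with a
character acting on `t`. -/
def laurentAction {K k H C : Type*} [Field K] [Field k] [Algebra K k] [Group H] [Group C]
    (η : H →* (k ≃ₐ[K] k)) (ψ : C →* Kˣ) :
    H × C →* (HahnSeries ℤ k ≃ₐ[K] HahnSeries ℤ k) :=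
  (AlgEquiv.algHomUnitsEquiv K (HahnSeries ℤ k)).toMonoidHom.comp <| MonoidHom.toHomUnits
    { toFun := fun g => laurentHom (η g.1) (ψ g.2)
      map_one' := by
        ext f n
        simp
      map_mul' := fun g h => by
        ext f n
        simp [mul_zpow, mul_smul] }

@[simp]
theorem coeff_laurentAction {K k H C : Type*} [Field K] [Field k] [Algebra K k] [Group H] [Group C]
    (η : H →* (k ≃ₐ[K] k)) (ψ : C →* Kˣ) (g : H × C) (f : HahnSeries ℤ k) (n : ℤ) :
    (laurentAction η ψ g f).coeff n = ((ψ g.2 ^ n : Kˣ) : K) • η g.1 (f.coeff n) := rfl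

theorem support_laurentAction {K k H C : Type*} [Field K] [Field k] [Algebra K k] [Group H]
    [Group C] (η : H →* (k ≃ₐ[K] k)) (ψ : C →* Kˣ) (g : H × C) (f : HahnSeries ℤ k) :
    (laurentAction η ψ g f).support = f.support := by
  ext n
  simp only [HahnSeries.mem_support, coeff_laurentAction, smul_ne_zero_iff, Units.ne_zero,
    ne_eq, not_false_eq_true, true_and, EmbeddingLike.map_eq_zero_iff]

theorem orderTop_laurentAction {K k H C : Type*} [Field K] [Field k] [Algebra K k] [Group H]
    [Group C] (η : H →* (k ≃ₐ[K] k)) (ψ : C →* Kˣ) (g : H × C) (f : HahnSeries ℤ k) :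
    (laurentAction η ψ g f).orderTop = f.orderTop := by
  by_cases hf : f = 0
  · simp [hf]
  · have hg : laurentAction η ψ g f ≠ 0 := by simpa using hf
    rw [HahnSeries.orderTop_of_ne_zero hf, HahnSeries.orderTop_of_ne_zero hg]
    simp only [support_laurentAction]

theorem order_laurentAction {K k H C : Type*} [Field K] [Field k] [Algebra K k] [Group H]
    [Group C] (η : H →* (k ≃ₐ[K] k)) (ψ : C →* Kˣ) (g : H × C) (f : HahnSeries ℤ k) :
    (laurentAction η ψ g f).order = f.order := by
  by_cases hf : f = 0
  · simp [hf]
  · have hg : laurentAction η ψ g f ≠ 0 := by simpa using hf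
    have h := orderTop_laurentAction η ψ g f
    rw [← HahnSeries.order_eq_orderTop_of_ne_zero hf,
      ← HahnSeries.order_eq_orderTop_of_ne_zero hg] at h
    exact_mod_cast h

theorem leadingCoeff_laurentAction {K k H C : Type*} [Field K] [Field k] [Algebra K k] [Group H]
    [Group C] (η : H →* (k ≃ₐ[K] k)) (ψ : C →* Kˣ) (g : H × C) (f : HahnSeries ℤ k) :
    (laurentAction η ψ g f).leadingCoeff =
      ((ψ g.2 ^ f.order : Kˣ) : K) • η g.1 f.leadingCoeff := by
  rw [HahnSeries.leadingCoeff_eq, HahnSeries.leadingCoeff_eq, coeff_laurentAction,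
    order_laurentAction]

theorem laurentAction_injective {K k H C : Type*} [Field K] [Field k] [Algebra K k] [Group H]
    [Group C] {η : H →* (k ≃ₐ[K] k)} {ψ : C →* Kˣ} (hη : Function.Injective η)
    (hψ : Function.Injective ψ) : Function.Injective (laurentAction η ψ) := by
  rw [injective_iff_map_eq_one]
  intro g hg
  have h : ∀ (x : k) (n : ℤ), ((ψ g.2 ^ n : Kˣ) : K) • η g.1 x = x := by
    intro x n
    have := congrArg (HahnSeries.coeff · n) (DFunLike.congr_fun hg (HahnSeries.single n x))
    simpa using this
  refine Prod.ext (hη ?_) (hψ ?_)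
  · ext x
    simpa using h x 0
  · have := h 1 1
    rw [map_one, ← Algebra.algebraMap_eq_smul_one, zpow_one] at this
    ext
    rw [Prod.snd_one, map_one, Units.val_one]
    exact (algebraMap K k).injective (this.trans (map_one _).symm)

instance infinite_hahnSeries_int {k : Type*} [Field k] : Infinite (HahnSeries ℤ k) :=
  Infinite.of_injective (fun n : ℤ => HahnSeries.single n (1 : k)) fun m n h => by
    have := congrArg HahnSeries.order h
    simpa [HahnSeries.order_single] using this

/-- The ring of power series in the field of Laurent series. -/
def powerSeriesSubalgebra (K k : Type*) [Field K] [Field k] [Algebra K k] :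
    Subalgebra K (HahnSeries ℤ k) where
  carrier := {f | 0 ≤ f.orderTop}
  mul_mem' := by
    intro f g hf hg
    rw [Set.mem_ofPred_eq] at hf hg ⊢
    rw [HahnSeries.orderTop_mul]
    exact add_nonneg hf hg
  add_mem' := by
    intro f g hf hg
    rw [Set.mem_ofPred_eq] at hf hg ⊢
    exact (le_min hf hg).trans HahnSeries.min_orderTop_le_orderTop_add
  algebraMap_mem' r := by
    rw [Set.mem_ofPred_eq, algebraMap_hahnSeries_int]
    exact HahnSeries.orderTop_single_le

theorem mem_powerSeriesSubalgebra {K k : Type*} [Field K] [Field k] [Algebra K k]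
    {f : HahnSeries ℤ k} : f ∈ powerSeriesSubalgebra K k ↔ 0 ≤ f.orderTop := by
  rfl

/-- The constant coefficient of a power series. -/
def constCoeffHom (K k : Type*) [Field K] [Field k] [Algebra K k] :
    powerSeriesSubalgebra K k →ₐ[K] k where
  toFun f := (f : HahnSeries ℤ k).coeff 0
  map_one' := by simp
  map_zero' := by simp
  map_add' f g := by simp
  map_mul' f g := by
    obtain ⟨f, hf⟩ := f
    obtain ⟨g, hg⟩ := g
    rw [mem_powerSeriesSubalgebra] at hf hg
    have hlt : ∀ (x : HahnSeries ℤ k), 0 ≤ x.orderTop → ∀ n : ℤ, n < 0 → x.coeff n = 0 :=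
      fun x hx n hn => HahnSeries.coeff_eq_zero_of_lt_orderTop
        ((WithTop.coe_lt_coe.2 hn).trans_le hx)
    change (f * g).coeff 0 = f.coeff 0 * g.coeff 0
    rw [HahnSeries.coeff_mul]
    refine (Finset.sum_subset_zero_on_sdiff (s₂ := {(0, 0)}) ?_ ?_ fun _ _ => rfl).trans
      (Finset.sum_singleton _ _)
    · rintro ⟨a, b⟩ h
      simp only [Finset.mem_antidiagonal, HahnSeries.mem_support] at h
      have h1 : 0 ≤ a := by
        by_contra h'
        exact h.1 (hlt f hf a (by omega))
      have h2 : 0 ≤ b := by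
        by_contra h'
        exact h.2.1 (hlt g hg b (by omega))
      rw [Finset.mem_singleton, Prod.mk.injEq]
      omega
    · rintro ⟨a, b⟩ h
      rw [Finset.mem_sdiff, Finset.mem_singleton] at h
      obtain ⟨h1, h2⟩ := h
      cases h1
      simp only [Finset.mem_antidiagonal, HahnSeries.mem_support, add_zero, and_true, not_and,
        not_not] at h2
      by_cases h3 : f.coeff 0 = 0
      · simp [h3]
      · simp [h2 h3]
  commutes' r := by
    simp [algebraMap_hahnSeries_int]

theorem inv_mem_powerSeriesSubalgebra {K k : Type*} [Field K] [Field k] [Algebra K k]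
    (f : powerSeriesSubalgebra K k) (hf : constCoeffHom K k f ≠ 0) :
    (f : HahnSeries ℤ k)⁻¹ ∈ powerSeriesSubalgebra K k := by
  rw [mem_powerSeriesSubalgebra]
  have h0 : (f : HahnSeries ℤ k).orderTop ≤ 0 := HahnSeries.orderTop_le_of_coeff_ne_zero hf
  have h1 : (f : HahnSeries ℤ k) ≠ 0 := fun h => hf (by
    change (f : HahnSeries ℤ k).coeff 0 = 0
    rw [h, HahnSeries.coeff_zero])
  have h2 := HahnSeries.orderTop_mul (f : HahnSeries ℤ k) (f : HahnSeries ℤ k)⁻¹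
  rw [mul_inv_cancel₀ h1, HahnSeries.orderTop_one,
    le_antisymm h0 (mem_powerSeriesSubalgebra.1 f.2), zero_add] at h2
  exact h2.le

namespace HahnSeries

/-- The leading coefficient as a multiplicative map. -/
def leadingCoeffHom (k : Type*) [Field k] : HahnSeries ℤ k →*₀ k where
  toFun := leadingCoeff
  map_zero' := leadingCoeff_zero
  map_one' := leadingCoeff_one
  map_mul' x y := leadingCoeff_mul x y

theorem leadingCoeff_zpow' {k : Type*} [Field k] (x : HahnSeries ℤ k) (n : ℤ) :
    (x ^ n).leadingCoeff = x.leadingCoeff ^ n :=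
  (map_zpow₀ (leadingCoeffHom k) x n :)

theorem order_inv' {k : Type*} [Field k] {x : HahnSeries ℤ k} (hx : x ≠ 0) :
    x⁻¹.order = -x.order := by
  have h := order_mul hx (inv_ne_zero hx)
  rw [mul_inv_cancel₀ hx, order_one] at h
  omega

theorem order_zpow' {k : Type*} [Field k] {x : HahnSeries ℤ k} (hx : x ≠ 0) (n : ℤ) :
    (x ^ n).order = n * x.order := by
  induction n with
  | zero => simp
  | succ n ih =>
    rw [zpow_add_one₀ hx, order_mul (zpow_ne_zero _ hx) hx, ih]
    ring
  | pred n ih =>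
    rw [zpow_sub_one₀ hx, order_mul (zpow_ne_zero _ hx) (inv_ne_zero hx), ih, order_inv' hx]
    ring

theorem exists_order_generator {K k : Type*} [Field K] [Field k] [Algebra K k]
    (E : IntermediateField K (HahnSeries ℤ k)) (hE : ∃ f ∈ E, f.order ≠ 0) :
    ∃ π ∈ E, 0 < π.order ∧ ∀ a ∈ E, a ≠ 0 → ∃ (u : HahnSeries ℤ k) (q : ℤ), u ∈ E ∧
      u.order = 0 ∧ a = u * π ^ q := by
  let S : AddSubgroup ℤ :=
    { carrier := {n | ∃ a ∈ E, a ≠ 0 ∧ a.order = n}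
      zero_mem' := ⟨1, one_mem _, one_ne_zero, order_one⟩
      add_mem' := by
        rintro _ _ ⟨a, ha, ha0, rfl⟩ ⟨b, hb, hb0, rfl⟩
        exact ⟨a * b, mul_mem ha hb, mul_ne_zero ha0 hb0, order_mul ha0 hb0⟩
      neg_mem' := by
        rintro _ ⟨a, ha, ha0, rfl⟩
        exact ⟨a⁻¹, inv_mem ha, inv_ne_zero ha0, order_inv' ha0⟩ }
  have hmem : ∀ a ∈ E, a ≠ 0 → a.order ∈ S := fun a ha ha0 => ⟨a, ha, ha0, rfl⟩
  obtain ⟨f, hf, hf0⟩ := hE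
  have hfS : f.order ∈ S := hmem f hf (by rintro rfl; exact hf0 order_zero)
  obtain ⟨e, he⟩ := Int.subgroup_cyclic S
  have hS : ∀ n ∈ S, ∃ q : ℤ, n = q * |e| := by
    intro n hn
    rw [he, AddSubgroup.mem_closure_singleton] at hn
    obtain ⟨q, rfl⟩ := hn
    rcases abs_choice e with h | h
    · exact ⟨q, by rw [h, smul_eq_mul]⟩
    · exact ⟨-q, by rw [h, smul_eq_mul]; ring⟩
  have heS : |e| ∈ S := by
    have : e ∈ S := by
      rw [he]
      exact AddSubgroup.subset_closure rfl
    rcases abs_choice e with h | h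
    · rwa [h]
    · rw [h]
      exact S.neg_mem this
  have he0 : 0 < |e| := by
    refine lt_of_le_of_ne (abs_nonneg e) fun h => hf0 ?_
    obtain ⟨q, hq⟩ := hS _ hfS
    rw [hq, ← h, mul_zero]
  obtain ⟨π, hπE, hπ0, hπ⟩ := heS
  refine ⟨π, hπE, hπ ▸ he0, fun a ha ha0 => ?_⟩
  obtain ⟨q, hq⟩ := hS _ (hmem a ha ha0)
  refine ⟨a * (π ^ q)⁻¹, q, mul_mem ha (inv_mem (zpow_mem hπE q)), ?_, ?_⟩
  · rw [order_mul ha0 (inv_ne_zero (zpow_ne_zero _ hπ0)), order_inv' (zpow_ne_zero _ hπ0),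
      order_zpow' hπ0, hq, hπ]
    ring
  · rw [inv_mul_cancel_right₀ (zpow_ne_zero _ hπ0)]

end HahnSeries

section

variable {K k H C : Type*} [Field K] [Field k] [Algebra K k] [Group H] [Group C]
  (η : H →* (k ≃ₐ[K] k)) (ψ : C →* Kˣ)

/-- The subgroup of elements preserving the leading coefficients of the elements of a stable set
of Laurent series. -/
def leadingFixer (S : Set (HahnSeries ℤ k)) (hS : ∀ g, ∀ a ∈ S, laurentAction η ψ g a ∈ S) :
    Subgroup (H × C) where
  carrier := {g | ∀ a ∈ S, (laurentAction η ψ g a).leadingCoeff = a.leadingCoeff}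
  one_mem' := by
    intro a _
    rw [map_one, AlgEquiv.one_apply]
  mul_mem' := by
    intro g h hg hh a ha
    rw [map_mul, AlgEquiv.mul_apply, hg _ (hS h a ha), hh a ha]
  inv_mem' := by
    intro g hg a ha
    rw [← hg _ (hS g⁻¹ a ha), ← AlgEquiv.mul_apply, ← map_mul, mul_inv_cancel, map_one,
      AlgEquiv.one_apply]

variable {η ψ}

theorem mem_leadingFixer {S : Set (HahnSeries ℤ k)}
    {hS : ∀ g, ∀ a ∈ S, laurentAction η ψ g a ∈ S} {g : H × C} : g ∈ leadingFixer η ψ S hS ↔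
      ∀ a ∈ S, (laurentAction η ψ g a).leadingCoeff = a.leadingCoeff := by
  rfl

theorem normal_leadingFixer (S : Set (HahnSeries ℤ k))
    (hS : ∀ g, ∀ a ∈ S, laurentAction η ψ g a ∈ S) : (leadingFixer η ψ S hS).Normal := by
  constructor
  intro g hg h
  rw [mem_leadingFixer] at hg ⊢
  intro a ha
  have hb := hS h⁻¹ a ha
  rw [map_mul, map_mul, AlgEquiv.mul_apply, AlgEquiv.mul_apply, leadingCoeff_laurentAction,
    order_laurentAction, hg _ hb, ← leadingCoeff_laurentAction, ← AlgEquiv.mul_apply,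
    ← map_mul, mul_inv_cancel, map_one, AlgEquiv.one_apply]

theorem eq_one_of_mem_leadingFixer {E : IntermediateField K (HahnSeries ℤ k)}
    (hE : IsFaithfulStable (laurentAction η ψ) E) {g : H × C}
    (hg : g ∈ leadingFixer η ψ E hE.1) {n : ℕ} (hn : (n : K) ≠ 0) (hgn : g ^ n = 1) : g = 1 := by
  by_contra hg1
  obtain ⟨a, ha, hne⟩ := hE.2 g hg1
  set b := laurentAction η ψ g a - a with hb
  have hb0 : b ≠ 0 := sub_ne_zero.2 hne
  have hbE : b ∈ E := sub_mem (hE.1 g a ha) ha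
  have hsum : ∑ i ∈ Finset.range n, laurentAction η ψ (g ^ i) b = 0 := by
    have h1 : ∀ i, laurentAction η ψ (g ^ i) b =
        laurentAction η ψ (g ^ (i + 1)) a - laurentAction η ψ (g ^ i) a := by
      intro i
      rw [hb, map_sub, pow_succ, map_mul, AlgEquiv.mul_apply]
    simp only [h1]
    rw [Finset.sum_range_sub (fun i => laurentAction η ψ (g ^ i) a), hgn, pow_zero, sub_self]
  have hcoeff : ∀ i, (laurentAction η ψ (g ^ i) b).coeff b.order = b.leadingCoeff := by
    intro i
    have h1 := mem_leadingFixer.1 (pow_mem hg i) b hbE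
    rwa [HahnSeries.leadingCoeff_eq, order_laurentAction] at h1
  have h2 := congrArg (HahnSeries.coeff · b.order) hsum
  simp only [HahnSeries.coeff_sum, hcoeff, Finset.sum_const, Finset.card_range,
    HahnSeries.coeff_zero, nsmul_eq_mul, mul_eq_zero, HahnSeries.leadingCoeff_eq_zero, hb0,
    or_false] at h2
  apply hn
  apply (algebraMap K k).injective
  rw [map_natCast, h2, map_zero]

theorem exists_order_ne_zero {E : IntermediateField K (HahnSeries ℤ k)}
    (hE : IsFaithfulStable (laurentAction η ψ) E) {c : C} (hc : c ≠ 1) :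
    ∃ f ∈ E, f.order ≠ 0 := by
  obtain ⟨x, hx, hne⟩ := hE.2 (1, c) fun h => hc (congrArg Prod.snd h)
  by_cases h0 : x.order = 0
  · refine ⟨laurentAction η ψ (1, c) x - x, sub_mem (hE.1 _ x hx) hx, fun h => ?_⟩
    apply HahnSeries.leadingCoeff_ne_zero.2 (sub_ne_zero.2 hne)
    rw [HahnSeries.leadingCoeff_eq, h, HahnSeries.coeff_sub, coeff_laurentAction]
    simp
  · exact ⟨x, hx, h0⟩

/-- The elements of order zero of an intermediate field of Laurent series. -/
def orderZeroSet (E : IntermediateField K (HahnSeries ℤ k)) : Set (HahnSeries ℤ k) :=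
  {a | a ∈ E ∧ a.order = 0}

theorem laurentAction_mem_orderZeroSet {E : IntermediateField K (HahnSeries ℤ k)}
    (hE : ∀ g, ∀ a ∈ E, laurentAction η ψ g a ∈ E) :
    ∀ g, ∀ a ∈ orderZeroSet E, laurentAction η ψ g a ∈ orderZeroSet E :=
  fun g a ha => ⟨hE g a ha.1, (order_laurentAction η ψ g a).trans ha.2⟩

end

/-- The subgroup of elements preserving the leading coefficients in degree zero consists of
central elements and embeds into the multiplicative group of the base field. -/
theorem exists_injective_hom_leadingFixer {K k H C : Type*} [Field K] [Field k] [Algebra K k]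
    [Group H] [Group C] [Finite H] [Finite C] {η : H →* (k ≃ₐ[K] k)} {ψ : C →* Kˣ}
    {E : IntermediateField K (HahnSeries ℤ k)} (hE : IsFaithfulStable (laurentAction η ψ) E)
    (hN : ∀ N : Subgroup (H × C), N.Normal →
      (∀ g ∈ N, ∀ n : ℕ, (n : K) ≠ 0 → g ^ n = 1 → g = 1) → N = ⊥)
    (hK : ∀ (x : k) (n : ℕ), n ≠ 0 → x ^ n = 1 → x ∈ (algebraMap K k).range)
    {π : HahnSeries ℤ k} (hπE : π ∈ E) (hπ0 : π ≠ 0)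
    (hπ : ∀ a ∈ E, a ≠ 0 → ∃ (u : HahnSeries ℤ k) (q : ℤ), u ∈ E ∧ u.order = 0 ∧ a = u * π ^ q)
    (I : Subgroup (H × C))
    (hI : I = leadingFixer η ψ (orderZeroSet E) (laurentAction_mem_orderZeroSet hE.1)) :
    (∀ g ∈ I, ∀ h, g * h = h * g) ∧ ∃ χ : I →* K, Function.Injective χ := by
  have hInorm : I.Normal := hI ▸ normal_leadingFixer _ _
  have hbot : leadingFixer η ψ (E : Set (HahnSeries ℤ k)) hE.1 = ⊥ :=
    hN _ (normal_leadingFixer _ _) fun g hg n hn hgn =>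
    eq_one_of_mem_leadingFixer hE hg hn hgn
  have hfix : ∀ g ∈ I, ∀ u ∈ E, u.order = 0 →
      (laurentAction η ψ g u).leadingCoeff = u.leadingCoeff := by
    intro g hg u hu hu0
    rw [hI] at hg
    exact mem_leadingFixer.1 hg u ⟨hu, hu0⟩
  have hlc : π.leadingCoeff ≠ 0 := HahnSeries.leadingCoeff_ne_zero.2 hπ0
  let χ : H × C → k := fun g => (laurentAction η ψ g π).leadingCoeff / π.leadingCoeff
  have hχ : ∀ g, (laurentAction η ψ g π).leadingCoeff = χ g * π.leadingCoeff := fun g =>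
    (div_mul_cancel₀ _ hlc).symm
  have hχ0 : ∀ g, χ g ≠ 0 := fun g => div_ne_zero (HahnSeries.leadingCoeff_ne_zero.2
    (by simpa using hπ0)) hlc
  have hχ1 : χ 1 = 1 := by
    simp only [χ, map_one, AlgEquiv.one_apply, div_self hlc]
  have hmul : ∀ g ∈ I, ∀ h, χ (g * h) = χ g * χ h := by
    intro g hg h
    let u := laurentAction η ψ h π / π
    have hu : laurentAction η ψ h π = u * π := (div_mul_cancel₀ _ hπ0).symm
    have hu0 : u.order = 0 := by
      rw [show u = laurentAction η ψ h π * π⁻¹ from div_eq_mul_inv _ _,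
        HahnSeries.order_mul (by simpa using hπ0) (inv_ne_zero hπ0), HahnSeries.order_inv' hπ0,
        order_laurentAction, add_neg_cancel]
    have huχ : u.leadingCoeff = χ h := by
      have := hχ h
      rw [hu, HahnSeries.leadingCoeff_mul] at this
      exact mul_right_cancel₀ hlc this
    have h1 := hχ (g * h)
    rw [map_mul, AlgEquiv.mul_apply, hu, map_mul, HahnSeries.leadingCoeff_mul,
      hfix g hg u (div_mem (hE.1 h π hπE) hπE) hu0, huχ, hχ, ← mul_assoc] at h1
    rw [← mul_right_cancel₀ hlc h1, mul_comm]
  have hinj : ∀ g ∈ I, χ g = 1 → g = 1 := by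
    intro g hg h1
    rw [← Subgroup.mem_bot, ← hbot, mem_leadingFixer]
    intro a ha
    by_cases ha0 : a = 0
    · rw [ha0, map_zero]
    obtain ⟨u, q, hu, hu0, rfl⟩ := hπ a ha ha0
    rw [map_mul, map_zpow₀, HahnSeries.leadingCoeff_mul, HahnSeries.leadingCoeff_mul,
      HahnSeries.leadingCoeff_zpow', HahnSeries.leadingCoeff_zpow', hfix g hg u hu hu0, hχ, h1,
      one_mul]
  have hpow : ∀ g ∈ I, ∀ n : ℕ, χ (g ^ n) = χ g ^ n := by
    intro g hg n
    induction n with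
    | zero => rw [pow_zero, pow_zero, hχ1]
    | succ n ih => rw [pow_succ', hmul g hg, ih, pow_succ']
  have hrange : ∀ g ∈ I, χ g ∈ (algebraMap K k).range := by
    intro g hg
    refine hK _ (orderOf g) (orderOf_pos g).ne' ?_
    rw [← hpow g hg, pow_orderOf_eq_one, hχ1]
  have hmul' : ∀ g ∈ I, ∀ h, χ (h * g) = χ g * χ h := by
    intro g hg h
    obtain ⟨r, hr⟩ := hrange g hg
    have h1 := hχ (h * g)
    rw [map_mul, AlgEquiv.mul_apply, leadingCoeff_laurentAction, order_laurentAction, hχ g, map_mul,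
      ← hr, AlgEquiv.commutes, ← mul_smul_comm, ← order_laurentAction η ψ h π,
      order_laurentAction, ← leadingCoeff_laurentAction, hχ h, ← mul_assoc] at h1
    rw [← mul_right_cancel₀ hlc h1, hr]
  have hinj' : ∀ g ∈ I, ∀ g' ∈ I, χ g = χ g' → g = g' := by
    intro g hg g' hg' h
    have h1 : χ (g * g'⁻¹) = 1 := by
      apply mul_right_cancel₀ (hχ0 g')
      rw [← hmul _ (mul_mem hg (inv_mem hg')), inv_mul_cancel_right, h, one_mul]
    exact mul_inv_eq_one.1 (hinj _ (mul_mem hg (inv_mem hg')) h1)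
  constructor
  · intro g hg h
    have hg' := hInorm.conj_mem g hg h⁻¹
    have h1 := hmul' _ hg' h
    rw [show h * (h⁻¹ * g * h⁻¹⁻¹) = g * h by group, hmul g hg] at h1
    have h2 := hinj' _ hg _ hg' (mul_right_cancel₀ (hχ0 h) h1)
    calc g * h = h * (h⁻¹ * g * h⁻¹⁻¹) := by group
      _ = h * g := by rw [← h2]
  · have hr : ∀ g : I, ∃ r : K, algebraMap K k r = χ g := fun g => hrange g g.2
    choose r hr using hr
    refine ⟨{ toFun := r, map_one' := ?_, map_mul' := ?_ }, ?_⟩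
    · apply (algebraMap K k).injective
      rw [hr, map_one, Subgroup.coe_one, hχ1]
    · intro g h
      apply (algebraMap K k).injective
      rw [hr, map_mul, hr, hr, Subgroup.coe_mul, hmul _ g.2]
    · intro g h hgh
      change r g = r h at hgh
      apply Subtype.ext
      exact hinj' _ g.2 _ h.2 (by rw [← hr, ← hr, hgh])

/-- A central subgroup of `H × C` containing `C` and embedding into the multiplicative group of a
field `K` meets `H` trivially, if `C` has order divisible by `p` and `K` contains no roots of unity
of other prime orders dividing the order of the center of `H`. -/
theorem eq_one_of_mem_of_injective_hom {K H C : Type*} [Field K] [Group H] [Group C] [Finite H]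
    {p : ℕ} (hroot : ∀ q : ℕ, q.Prime → q ∣ Nat.card (Subgroup.center H) → q ≠ p →
      ¬ ∃ ζ : K, IsPrimitiveRoot ζ q)
    {c : C} (hc : orderOf c = p) {I : Subgroup (H × C)} (hcI : ((1 : H), c) ∈ I)
    (hI : ∀ g ∈ I, ∀ h, g * h = h * g) {χ : I →* K} (hχ : Function.Injective χ) {g : H}
    (hg : (g, (1 : C)) ∈ I) : g = 1 := by
  by_contra hg1
  obtain ⟨q, hq, hqd⟩ := Nat.exists_prime_and_dvd (mt orderOf_eq_one_iff.1 hg1)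
  let x := g ^ (orderOf g / q)
  have hx : orderOf x = q := orderOf_pow_orderOf_div (orderOf_pos g).ne' hqd
  have hxI : (x, (1 : C)) ∈ I := by
    simpa [x] using pow_mem hg (orderOf g / q)
  have hxI' : orderOf (⟨(x, 1), hxI⟩ : I) = q := by
    rw [Subgroup.orderOf_mk, Prod.orderOf_mk, hx, orderOf_one, Nat.lcm_one_right]
  have hζ := IsPrimitiveRoot.orderOf (χ ⟨(x, 1), hxI⟩)
  rw [orderOf_injective χ hχ, hxI'] at hζ
  have hxc : x ∈ Subgroup.center H := by
    rw [Subgroup.mem_center_iff]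
    intro y
    exact (congrArg Prod.fst (hI _ hxI (y, 1))).symm
  have hqc : q ∣ Nat.card (Subgroup.center H) := by
    have := orderOf_dvd_natCard (⟨x, hxc⟩ : Subgroup.center H)
    rwa [Subgroup.orderOf_mk, hx] at this
  by_cases hqp : q = p
  · have hcI' : orderOf (⟨(1, c), hcI⟩ : I) = p := by
      rw [Subgroup.orderOf_mk, Prod.orderOf_mk, orderOf_one, hc, Nat.lcm_one_left]
    have hζ' := IsPrimitiveRoot.orderOf (χ ⟨(1, c), hcI⟩)
    rw [orderOf_injective χ hχ, hcI', ← hqp] at hζ'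
    have : NeZero q := ⟨hq.ne_zero⟩
    obtain ⟨i, -, hi⟩ := hζ'.eq_pow_of_pow_eq_one hζ.pow_eq_one
    rw [← map_pow] at hi
    have h1 := congrArg (fun z : I => z.1.1) (hχ hi)
    have h2 : x = 1 := by simpa using h1.symm
    rw [h2, orderOf_one] at hx
    exact hq.one_lt.ne hx
  · exact hroot q hq hqc hqp ⟨_, hζ⟩

theorem mem_range_algebraMap_fnField_of_pow_eq_one {K σ : Type*} [Field K] {x : FnField K σ}
    {n : ℕ} (hn : n ≠ 0) (hx : x ^ n = 1) : x ∈ (algebraMap K (FnField K σ)).range := by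
  have hint : IsIntegral (MvPolynomial σ K) x :=
    IsIntegral.of_pow (Nat.pos_of_ne_zero hn) (hx ▸ isIntegral_one)
  obtain ⟨y, rfl⟩ := IsIntegrallyClosed.isIntegral_iff.1 hint
  have hy : y ^ n = 1 := by
    apply IsFractionRing.injective (MvPolynomial σ K) (FnField K σ)
    rw [map_pow, hx, map_one]
  obtain ⟨r, -, rfl⟩ := MvPolynomial.isUnit_iff_eq_C_of_isReduced.1 (IsUnit.of_pow_eq_one hy hn)
  exact ⟨r, IsScalarTower.algebraMap_apply K (MvPolynomial σ K) (FnField K σ) r⟩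

theorem eq_bot_of_forall_pow_eq_one {K G : Type*} [Field K] [Group G] [Finite G]
    (hchar : ringChar K = 0 ∨ (ringChar K ≠ 0 ∧
      ∀ N : Subgroup G, N.Normal → IsPGroup (ringChar K) N → N = ⊥))
    {N : Subgroup G} (hN : N.Normal)
    (h : ∀ g ∈ N, ∀ n : ℕ, (n : K) ≠ 0 → g ^ n = 1 → g = 1) : N = ⊥ := by
  rcases hchar with h0 | ⟨h0, hl⟩
  · rw [Subgroup.eq_bot_iff_forall]
    intro g hg
    refine h g hg (orderOf g) ?_ (pow_orderOf_eq_one g)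
    rw [Ne, ringChar.spec, h0, zero_dvd_iff]
    exact (orderOf_pos g).ne'
  · refine hl N hN fun g => ?_
    have hprime : (ringChar K).Prime :=
      (CharP.char_is_prime_or_zero K (ringChar K)).resolve_right h0
    obtain ⟨a, m, hm, ham⟩ := Nat.exists_eq_pow_mul_and_not_dvd (orderOf_pos (g : G)).ne'
      (ringChar K) hprime.ne_one
    refine ⟨a, Subtype.ext ?_⟩
    refine h _ (pow_mem g.2 _) m ?_ ?_
    · rwa [Ne, ringChar.spec]
    · rw [Subgroup.coe_pow, ← pow_mul, ← ham, pow_orderOf_eq_one]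

/-- The lower bound, from the place of the field of Laurent series over the rational function field
of `H`. -/
theorem edK_add_one_le {K H C : Type*} [Field K] [Group H] [Finite H] [Group C] [Finite C]
    (hchar : ringChar K = 0 ∨ (ringChar K ≠ 0 ∧
      ∀ N : Subgroup (H × C), N.Normal → IsPGroup (ringChar K) N → N = ⊥))
    {p : ℕ} (hroot : ∀ q : ℕ, q.Prime → q ∣ Nat.card (Subgroup.center H) → q ≠ p →
      ¬ ∃ ζ : K, IsPrimitiveRoot ζ q)
    {c : C} (hc : orderOf c = p) (hc1 : c ≠ 1) {ψ : C →* Kˣ} (hψ : Function.Injective ψ) :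
    edK K H + 1 ≤ edK K (H × C) := by
  have hη : Function.Injective (galAction K H) := by
    rw [injective_iff_map_eq_one]
    intro g hg
    by_contra hg1
    obtain ⟨x, -, hx⟩ := (isFaithfulStable_galAction_top K H).2 g hg1
    exact hx (by rw [hg, AlgEquiv.one_apply])
  obtain ⟨E₀, hE₀, hd₀⟩ := exists_isFaithfulStable_edK K (H × C)
  obtain ⟨E, hE, hd⟩ := hE₀.exists_of_infinite (laurentAction_injective hη hψ) hd₀
  obtain ⟨π, hπE, hπ, hgen⟩ := HahnSeries.exists_order_generator E (exists_order_ne_zero hE hc1)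
  have hπ0 : π ≠ 0 := by
    rintro rfl
    exact hπ.ne' HahnSeries.order_zero
  obtain ⟨hcen, χ, hχ⟩ := exists_injective_hom_leadingFixer hE
    (fun N hN h => eq_bot_of_forall_pow_eq_one hchar hN h)
    (fun x n hn hx => mem_range_algebraMap_fnField_of_pow_eq_one hn hx) hπE hπ0 hgen _ rfl
  have hzero : ∀ a : HahnSeries ℤ (FnField K H), a.order = 0 → 0 ≤ a.orderTop := by
    intro a ha
    by_cases ha0 : a = 0
    · simp [ha0]
    · rw [← HahnSeries.order_eq_orderTop_of_ne_zero ha0, ha]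
      rfl
  have hO := inv_mem_powerSeriesSubalgebra (K := K) (k := FnField K H)
  have hR : IsFaithfulStable (galAction K H) (residueField _ _ hO E) := by
    refine isFaithfulStable_residueField
      ((laurentAction (galAction K H) ψ).comp (MonoidHom.inl H C)) (galAction K H) hO ?_
      (fun g x hx => hE.1 _ x hx) ?_
    · intro g x
      refine ⟨?_, ?_⟩
      · rw [mem_powerSeriesSubalgebra]
        exact (mem_powerSeriesSubalgebra.1 x.2).trans_eq (orderTop_laurentAction _ _ _ _).symm
      · change (laurentAction (galAction K H) ψ (g, 1) x).coeff 0 = _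
        rw [coeff_laurentAction, zpow_zero, Units.val_one, one_smul]
        rfl
    · intro g hg
      by_contra! hcon
      refine hg (eq_one_of_mem_of_injective_hom hroot hc ?_ hcen hχ (g := g) ?_)
      · rw [mem_leadingFixer]
        rintro a ⟨ha, ha0⟩
        rw [leadingCoeff_laurentAction, ha0, zpow_zero, Units.val_one, one_smul, map_one,
          AlgEquiv.one_apply]
      · rw [mem_leadingFixer]
        rintro a ⟨ha, ha0⟩
        have h1 := hcon ⟨a, mem_powerSeriesSubalgebra.2 (hzero a ha0)⟩ ha
        change galAction K H g (a.coeff 0) = a.coeff 0 at h1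
        rw [leadingCoeff_laurentAction, ha0, zpow_zero, Units.val_one, one_smul,
          HahnSeries.leadingCoeff_eq, ha0, h1]
  have hπO : π ∈ powerSeriesSubalgebra K (FnField K H) := by
    rw [mem_powerSeriesSubalgebra, ← HahnSeries.order_eq_orderTop_of_ne_zero hπ0]
    exact_mod_cast hπ.le
  have htr := trdeg_residueField_add_one_le _ (constCoeffHom K (FnField K H)) hO E hd
    (a := ⟨π, hπO⟩) hπE (fun h => hπ0 (congrArg Subtype.val h))
    (HahnSeries.coeff_eq_zero_of_lt_order hπ)
  obtain ⟨m, hm⟩ := Cardinal.lt_aleph0.1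
    ((self_le_add_right _ _).trans_lt (htr.trans_lt (Cardinal.natCast_lt_aleph0)))
  rw [hm] at htr
  have hle := edK_le hR hm.le
  have : m + 1 ≤ edK K (H × C) := by exact_mod_cast htr
  omega

/-- Theorem 4.6 (split central extension theorem): let `p` be a prime, `G'` a finite
group, `G = G' × ℤ/pℤ`, and `K` a field such that (i) `char K = 0`, or `char K = l > 0`
and `G` has no non-trivial normal `l`-subgroup; (ii) `K` contains a primitive `p`-th
root of unity; (iii) for every prime `p' ≠ p` dividing `|Z(G')|`, `K` contains no
primitive `p'`-th root of unity.  Then `ed_K(G) = ed_K(G') + 1`. -/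
theorem edK_split_central_extension (K : Type*) [Field K]
    (G' : Type*) [Group G'] [Finite G'] (p : ℕ) (hp : p.Prime)
    (hchar : ringChar K = 0 ∨ (ringChar K ≠ 0 ∧
      ∀ H : Subgroup (G' × Multiplicative (ZMod p)), H.Normal →
        IsPGroup (ringChar K) H → H = ⊥))
    (hroot : ∃ ζ : K, IsPrimitiveRoot ζ p)
    (hroot' : ∀ p' : ℕ, p'.Prime → p' ∣ Nat.card (Subgroup.center G') → p' ≠ p →
      ¬ ∃ ζ : K, IsPrimitiveRoot ζ p') :
    edK K (G' × Multiplicative (ZMod p)) = edK K G' + 1 := by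
  obtain ⟨ζ, hζ⟩ := hroot
  have : Fact p.Prime := ⟨hp⟩
  have hu := hζ.isUnit_unit hp.ne_zero
  let ψ : Multiplicative (ZMod p) →* Kˣ :=
    (Subgroup.zpowers _).subtype.comp hu.zmodEquivZPowers.toMultiplicativeLeft.toMonoidHom
  have hψ : Function.Injective ψ :=
    Subtype.val_injective.comp hu.zmodEquivZPowers.toMultiplicativeLeft.injective
  have hc : orderOf (Multiplicative.ofAdd (1 : ZMod p)) = p := by
    rw [orderOf_ofAdd_eq_addOrderOf, ZMod.addOrderOf_one]
  refine le_antisymm (edK_prod_le ψ hψ) (edK_add_one_le hchar hroot' hc (fun h => ?_) hψ)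
  rw [h, orderOf_one] at hc
  exact hp.one_lt.ne hc
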